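/- arXiv:1101.5584 — 2 statements merged into one kernel-verified Lean document; each statement's English description precedes it below -/
import Mathlib

section
/- Let T(y) = p y'' + q y' + r y be a second-order operator with rational coefficients, nonpolynomial (having at least one pole), that leaves invariant a codimension-1 subspace U ⊂ P_n with n ≥ 5. Then T has exactly one pole, and up to a translation in x, U has a basis of one of the three forms: (i) x, x², ..., x^n; (ii) 1 + a x, x², ..., x^n; (iii) 1 + a₁x², x + a₂x², x³, ..., x^n. -/
open Polynomial

/-- The second-order operator `T(y) = p y'' + q y' + r y` with rational coefficients,
applied to a polynomial `y`. -/
noncomputable def TR (p q r : RatFunc ℝ) (y : Polynomial ℝ) : RatFunc ℝ :=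
  p * algebraMap (Polynomial ℝ) (RatFunc ℝ) (derivative (derivative y)) +
  q * algebraMap (Polynomial ℝ) (RatFunc ℝ) (derivative y) +
  r * algebraMap (Polynomial ℝ) (RatFunc ℝ) y

namespace S6

/-- The functional `α f(c) + β f'(c) + γ f''(c)`. -/
noncomputable def jet (c α β γ : ℂ) : ℂ[X] →ₗ[ℂ] ℂ :=
  α • (leval c) + β • ((leval c).comp derivative) +
    γ • ((leval c).comp (derivative.comp derivative))

lemma jet_apply (c α β γ : ℂ) (f : ℂ[X]) : jet c α β γ f =
    α * f.eval c + β * (derivative f).eval c + γ * (derivative (derivative f)).eval c := by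
  simp [jet, leval]

lemma lin_zero (L : ℂ[X] →ₗ[ℂ] ℂ) (n : ℕ) (h : ∀ k ≤ n, L (X ^ k) = 0) (f : ℂ[X])
    (hf : f.natDegree ≤ n) : L f = 0 := by
  rw [f.as_sum_range_C_mul_X_pow, map_sum]
  refine Finset.sum_eq_zero fun i hi => ?_
  rw [← smul_eq_C_mul, map_smul, h i (by simp at hi; omega), smul_zero]

lemma jet_indep (c d α β γ α' β' γ' : ℂ) (hcd : c ≠ d)
    (h : ∀ f : ℂ[X], f.natDegree ≤ 5 → jet c α β γ f + jet d α' β' γ' f = 0) :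
    α' = 0 ∧ β' = 0 ∧ γ' = 0 := by
  have hdc : d - c ≠ 0 := sub_ne_zero.mpr hcd.symm
  have h2 := h ((X - C c) ^ 3 * (X - C d) ^ 2) (by compute_degree)
  have h1 := h ((X - C c) ^ 3 * (X - C d)) (by compute_degree; try norm_num)
  have h0 := h ((X - C c) ^ 3) (by compute_degree; try norm_num)
  simp [jet_apply, derivative_pow] at h2 h1 h0
  have hγ : γ' = 0 := by
    rcases h2 with h | h
    · exact h
    · exact absurd h hdc
  subst hγ
  have hβ : β' = 0 := by
    simp at h1
    rcases h1 with h | h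
    · exact h
    · exact absurd h hdc
  subst hβ
  simp at h0
  exact ⟨h0.resolve_right hdc, rfl, rfl⟩

lemma cross_exists {ι : Type*} (a b e : ι → ℂ)
    (h : ∀ i j k, a i * (b j * e k - e j * b k) - b i * (a j * e k - e j * a k)
      + e i * (a j * b k - b j * a k) = 0) :
    ∃ α β γ : ℂ, ¬ (α = 0 ∧ β = 0 ∧ γ = 0) ∧ ∀ i, α * a i + β * b i + γ * e i = 0 := by
  by_cases hx : ∃ j k, ¬ (b j * e k - e j * b k = 0 ∧ -(a j * e k - e j * a k) = 0 ∧
      a j * b k - b j * a k = 0)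
  · obtain ⟨j, k, hjk⟩ := hx
    exact ⟨_, _, _, hjk, fun i => by linear_combination h i j k⟩
  · push Not at hx
    by_cases hu : ∃ j, ¬ (a j = 0 ∧ b j = 0)
    · obtain ⟨j, hj⟩ := hu
      refine ⟨b j, -a j, 0, ?_, fun i => ?_⟩
      · rintro ⟨h1, h2, -⟩
        exact hj ⟨neg_eq_zero.mp h2, h1⟩
      · linear_combination -(hx j i).2.2
    · push Not at hu
      exact ⟨1, 0, 0, by simp, fun i => by simp [(hu i).1]⟩

/-- The Wronskian. -/
noncomputable def W (y1 y2 y3 : ℝ[X]) : ℝ[X] :=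
  y1 * (derivative y2 * derivative (derivative y3) - derivative (derivative y2) * derivative y3)
  - derivative y1 * (y2 * derivative (derivative y3) - derivative (derivative y2) * y3)
  + derivative (derivative y1) * (y2 * derivative y3 - derivative y2 * y3)

lemma den_dvd (p : RatFunc ℝ) (w P : ℝ[X])
    (h : p * algebraMap ℝ[X] (RatFunc ℝ) w = algebraMap ℝ[X] (RatFunc ℝ) P) :
    p.denom ∣ w := by
  by_cases hw : w = 0
  · simp [hw]
  · rw [RatFunc.denom_dvd hw]
    refine ⟨P, ?_⟩
    rw [eq_div_iff (by simpa using hw), h]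

lemma cramer (p q r : RatFunc ℝ) (y1 y2 y3 z1 z2 z3 : ℝ[X])
    (h1 : TR p q r y1 = algebraMap ℝ[X] (RatFunc ℝ) z1)
    (h2 : TR p q r y2 = algebraMap ℝ[X] (RatFunc ℝ) z2)
    (h3 : TR p q r y3 = algebraMap ℝ[X] (RatFunc ℝ) z3) :
    p.denom ∣ W y1 y2 y3 ∧ q.denom ∣ W y1 y2 y3 ∧ r.denom ∣ W y1 y2 y3 := by
  unfold TR at h1 h2 h3
  refine ⟨den_dvd _ _ (y1 * (derivative y2 * z3 - z2 * derivative y3)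
      - derivative y1 * (y2 * z3 - z2 * y3) + z1 * (y2 * derivative y3 - derivative y2 * y3)) ?_,
    den_dvd _ _ (y1 * (z2 * derivative (derivative y3) - derivative (derivative y2) * z3)
      - z1 * (y2 * derivative (derivative y3) - derivative (derivative y2) * y3)
      + derivative (derivative y1) * (y2 * z3 - z2 * y3)) ?_,
    den_dvd _ _ (z1 * (derivative y2 * derivative (derivative y3)
        - derivative (derivative y2) * derivative y3)
      - derivative y1 * (z2 * derivative (derivative y3) - derivative (derivative y2) * z3)
      + derivative (derivative y1) * (z2 * derivative y3 - derivative y2 * z3)) ?_⟩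
  all_goals
    simp only [W, map_add, map_sub, map_mul, ← h1, ← h2, ← h3]
    ring

/-- `c` is a complex pole. -/
def Bad (p q r : RatFunc ℝ) (c : ℂ) : Prop :=
  aeval c p.denom = 0 ∨ aeval c q.denom = 0 ∨ aeval c r.denom = 0

lemma bad_jet (U : Submodule ℝ ℝ[X]) (p q r : RatFunc ℝ)
    (hinv : ∀ y ∈ U, ∃ z ∈ U, TR p q r y = algebraMap (Polynomial ℝ) (RatFunc ℝ) z)
    (c : ℂ) (hc : Bad p q r c) :
    ∃ α β γ : ℂ, ¬ (α = 0 ∧ β = 0 ∧ γ = 0) ∧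
      ∀ y ∈ U, jet c α β γ (y.map (algebraMap ℝ ℂ)) = 0 := by
  have hW : ∀ y1 ∈ U, ∀ y2 ∈ U, ∀ y3 ∈ U, aeval c (W y1 y2 y3) = 0 := by
    intro y1 h1 y2 h2 y3 h3
    obtain ⟨z1, -, e1⟩ := hinv y1 h1
    obtain ⟨z2, -, e2⟩ := hinv y2 h2
    obtain ⟨z3, -, e3⟩ := hinv y3 h3
    obtain ⟨⟨u, hp⟩, ⟨v, hq⟩, ⟨w, hr⟩⟩ := cramer p q r y1 y2 y3 z1 z2 z3 e1 e2 e3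
    rcases hc with h | h | h
    · rw [hp, map_mul, h, zero_mul]
    · rw [hq, map_mul, h, zero_mul]
    · rw [hr, map_mul, h, zero_mul]
  obtain ⟨α, β, γ, hne, h⟩ := cross_exists (fun y : U => aeval c (y : ℝ[X]))
    (fun y : U => aeval c (derivative (y : ℝ[X])))
    (fun y : U => aeval c (derivative (derivative (y : ℝ[X])))) (by
      intro i j k
      have := hW i i.2 j j.2 k k.2
      simpa [W] using this)
  refine ⟨α, β, γ, hne, fun y hy => ?_⟩
  have := h ⟨y, hy⟩
  simpa [jet_apply, derivative_map, eval_map_algebraMap] using this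

lemma codim (n : ℕ) (U : Submodule ℝ ℝ[X])
    (hUP : U ≤ Polynomial.degreeLT ℝ (n + 1)) (hdim : Module.finrank ℝ U = n) :
    ∃ g : ℝ[X], ∀ f ∈ degreeLT ℝ (n + 1), ∃ t : ℝ, f - t • g ∈ U := by
  have hfin : Module.Finite ℝ (degreeLT ℝ (n + 1)) :=
    Module.Finite.equiv (degreeLTEquiv ℝ (n + 1)).symm
  have hrank : Module.finrank ℝ (degreeLT ℝ (n + 1)) = n + 1 := by
    rw [(degreeLTEquiv ℝ (n + 1)).finrank_eq]; simp
  have hne : ∃ g ∈ degreeLT ℝ (n + 1), g ∉ U := by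
    by_contra hcon
    push Not at hcon
    have : U = degreeLT ℝ (n + 1) := le_antisymm hUP hcon
    rw [this, hrank] at hdim
    omega
  obtain ⟨g, hg, hgU⟩ := hne
  refine ⟨g, fun f hf => ?_⟩
  have hle : U ⊔ Submodule.span ℝ {g} ≤ degreeLT ℝ (n + 1) :=
    sup_le hUP (by rw [Submodule.span_singleton_le_iff_mem]; exact hg)
  have hlt : U < U ⊔ Submodule.span ℝ {g} := by
    refine lt_of_le_of_ne le_sup_left fun h => hgU ?_
    rw [h]
    exact Submodule.mem_sup_right (Submodule.mem_span_singleton_self g)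
  have hf2 : Module.Finite ℝ ↥(U ⊔ Submodule.span ℝ {g}) :=
    Submodule.finiteDimensional_of_le hle
  have h3 := Submodule.finrank_lt_finrank_of_lt hlt
  have heq : U ⊔ Submodule.span ℝ {g} = degreeLT ℝ (n + 1) :=
    Submodule.eq_of_le_of_finrank_le hle (by omega)
  rw [← heq, Submodule.mem_sup] at hf
  obtain ⟨u, hu, v, hv, rfl⟩ := hf
  obtain ⟨t, rfl⟩ := Submodule.mem_span_singleton.mp hv
  exact ⟨t, by simpa using hu⟩

lemma bad_unique (n : ℕ) (hn : 5 ≤ n) (U : Submodule ℝ ℝ[X])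
    (hUP : U ≤ Polynomial.degreeLT ℝ (n + 1)) (hdim : Module.finrank ℝ U = n)
    (p q r : RatFunc ℝ)
    (hinv : ∀ y ∈ U, ∃ z ∈ U, TR p q r y = algebraMap (Polynomial ℝ) (RatFunc ℝ) z)
    (c d : ℂ) (hc : Bad p q r c) (hd : Bad p q r d) : c = d := by
  by_contra hcd
  obtain ⟨α, β, γ, hne, h1⟩ := bad_jet U p q r hinv c hc
  obtain ⟨α', β', γ', hne', h2⟩ := bad_jet U p q r hinv d hd
  obtain ⟨g, hg⟩ := codim n U hUP hdim
  set A := jet c α β γ (g.map (algebraMap ℝ ℂ)) with hA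
  set B := jet d α' β' γ' (g.map (algebraMap ℝ ℂ)) with hB
  have key : ∀ k ≤ n, ∃ t : ℂ, jet c α β γ (X ^ k) = t * A ∧ jet d α' β' γ' (X ^ k) = t * B := by
    intro k hk
    obtain ⟨t, ht⟩ := hg (X ^ k) (by
      rw [mem_degreeLT, degree_X_pow]; exact_mod_cast Nat.lt_succ_of_le hk)
    have hm : ((X ^ k - t • g : ℝ[X])).map (algebraMap ℝ ℂ)
        = X ^ k - (t : ℂ) • g.map (algebraMap ℝ ℂ) := by
      rw [Polynomial.map_sub, Polynomial.map_smul]; simp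
    have e1 := h1 _ ht
    have e2 := h2 _ ht
    rw [hm, map_sub, map_smul, sub_eq_zero, smul_eq_mul] at e1 e2
    exact ⟨t, e1, e2⟩
  have fin : ∀ s t : ℂ, s * A + t * B = 0 → t = 0 ∧ s = 0 := by
    intro s t hst
    have hz : ∀ f : ℂ[X], f.natDegree ≤ n → (s • jet c α β γ + t • jet d α' β' γ') f = 0 := by
      refine lin_zero _ n fun k hk => ?_
      obtain ⟨w, e1, e2⟩ := key k hk
      simp only [LinearMap.add_apply, LinearMap.smul_apply, smul_eq_mul, e1, e2]
      linear_combination w * hst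
    have i1 := jet_indep c d (s * α) (s * β) (s * γ) (t * α') (t * β') (t * γ') hcd (by
      intro f hf
      have := hz f (hf.trans hn)
      simp only [LinearMap.add_apply, LinearMap.smul_apply, smul_eq_mul, jet_apply] at this ⊢
      linear_combination this)
    have i2 := jet_indep d c (t * α') (t * β') (t * γ') (s * α) (s * β) (s * γ) (Ne.symm hcd) (by
      intro f hf
      have := hz f (hf.trans hn)
      simp only [LinearMap.add_apply, LinearMap.smul_apply, smul_eq_mul, jet_apply] at this ⊢
      linear_combination this)
    constructor
    · by_contra h0
      simp [h0] at i1
      exact hne' i1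
    · by_contra h0
      simp [h0] at i2
      exact hne i2
  have hB0 := fin B (-A) (by ring)
  have := fin 1 0 (by rw [neg_eq_zero.mp hB0.1]; ring)
  simp at this

lemma monic_eq (D : ℝ[X]) (hD : D.Monic) (x₀ : ℝ)
    (h : ∀ c : ℂ, aeval c D = 0 → c = x₀) : D = (X - C x₀) ^ D.natDegree := by
  apply Polynomial.map_injective (algebraMap ℝ ℂ) (algebraMap ℝ ℂ).injective
  have hm : (D.map (algebraMap ℝ ℂ)).Monic := hD.map _
  have hs : (D.map (algebraMap ℝ ℂ)).Splits := IsAlgClosed.splits _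
  have hr : (D.map (algebraMap ℝ ℂ)).roots = Multiset.replicate D.natDegree (x₀ : ℂ) := by
    rw [Multiset.eq_replicate]
    constructor
    · rw [← hs.natDegree_eq_card_roots, natDegree_map]
    · intro b hb
      apply h
      have := (mem_roots'.mp hb).2
      rwa [IsRoot, eval_map_algebraMap] at this
  rw [hs.eq_prod_roots_of_monic hm, hr]
  simp

lemma denom_mul (p : RatFunc ℝ) (x₀ : ℝ) (N : ℕ) (h : p.denom ∣ (X - C x₀) ^ N) :
    ∃ P : ℝ[X], p * algebraMap (Polynomial ℝ) (RatFunc ℝ) ((X - C x₀) ^ N) =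
          algebraMap (Polynomial ℝ) (RatFunc ℝ) P := by
  obtain ⟨u, hu⟩ := h
  refine ⟨p.num * u, ?_⟩
  have hd : algebraMap ℝ[X] (RatFunc ℝ) p.denom ≠ 0 := by simpa using p.denom_ne_zero
  rw [hu, map_mul, map_mul]
  nth_rewrite 1 [← RatFunc.num_div_denom p]
  field_simp

lemma bad_of_denom (p : RatFunc ℝ) (h : ¬ ∃ P : Polynomial ℝ, p = algebraMap _ (RatFunc ℝ) P) :
    ∃ c : ℂ, aeval c p.denom = 0 := by
  apply IsAlgClosed.exists_aeval_eq_zero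
  intro h0
  apply h
  have h1 : p.denom = 1 := by
    rw [eq_C_of_degree_eq_zero h0]
    have := p.monic_denom
    have hz : p.denom.natDegree = 0 := natDegree_eq_of_degree_eq_some h0
    rw [Monic, leadingCoeff, hz] at this
    rw [this]; simp
  refine ⟨p.num, ?_⟩
  conv_lhs => rw [← RatFunc.num_div_denom p, h1]
  simp

lemma span_eq (n : ℕ) (V : Submodule ℝ ℝ[X]) (hdim : Module.finrank ℝ V = n)
    (s : Finset ℝ[X]) (hs : s.card ≤ n) (h : V ≤ Submodule.span ℝ (s : Set ℝ[X])) :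
    V = Submodule.span ℝ (s : Set ℝ[X]) := by
  have : Module.Finite ℝ (Submodule.span ℝ (s : Set ℝ[X])) :=
    FiniteDimensional.span_finset ℝ s
  exact Submodule.eq_of_le_of_finrank_le h
    ((finrank_span_finset_le_card s).trans (hs.trans hdim.ge))

lemma expand (n : ℕ) (f : ℝ[X]) (hf : f ∈ degreeLT ℝ (n + 1)) :
    f = ∑ i ∈ Finset.range (n + 1), f.coeff i • (X : ℝ[X]) ^ i := by
  rw [mem_degreeLT] at hf
  have : f.natDegree < n + 1 := by
    by_cases h0 : f = 0
    · simp [h0]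
    · exact (natDegree_lt_iff_degree_lt h0).mpr hf
  conv_lhs => rw [f.as_sum_range' (n + 1) this]
  simp [← C_mul_X_pow_eq_monomial, smul_eq_C_mul]

lemma expand' (n k : ℕ) (hk : k ≤ n) (f : ℝ[X]) (hf : f ∈ degreeLT ℝ (n + 1)) :
    ∃ g ∈ Submodule.span ℝ ((fun i => (X : ℝ[X]) ^ i) '' {i | k ≤ i ∧ i ≤ n}),
      f = (∑ i ∈ Finset.range k, f.coeff i • (X : ℝ[X]) ^ i) + g := by
  refine ⟨∑ i ∈ Finset.Ico k (n + 1), f.coeff i • (X : ℝ[X]) ^ i, ?_, ?_⟩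
  · refine Submodule.sum_mem _ fun i hi => Submodule.smul_mem _ _ (Submodule.subset_span ⟨i, ?_, rfl⟩)
    simp at hi ⊢; omega
  · rw [Finset.sum_range_add_sum_Ico _ (by omega)]
    exact expand n f hf

lemma forms (n : ℕ) (hn : 5 ≤ n) (V : Submodule ℝ ℝ[X])
    (hVP : V ≤ Polynomial.degreeLT ℝ (n + 1)) (hdim : Module.finrank ℝ V = n)
    (α β γ : ℝ) (hne : ¬ (α = 0 ∧ β = 0 ∧ γ = 0))
    (h : ∀ f ∈ V, α * f.coeff 0 + β * f.coeff 1 + γ * f.coeff 2 = 0) :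
    V = Submodule.span ℝ ((fun i => (X : Polynomial ℝ) ^ i) '' {i | 1 ≤ i ∧ i ≤ n}) ∨
        (∃ a : ℝ, V = Submodule.span ℝ ({1 + C a * X} ∪
            (fun i => (X : Polynomial ℝ) ^ i) '' {i | 2 ≤ i ∧ i ≤ n})) ∨
        (∃ a₁ a₂ : ℝ, V =
          Submodule.span ℝ ({1 + C a₁ * X ^ 2, X + C a₂ * X ^ 2} ∪
            (fun i => (X : Polynomial ℝ) ^ i) '' {i | 3 ≤ i ∧ i ≤ n})) := by
  classical
  have hset : ∀ k, ((fun i => (X : ℝ[X]) ^ i) '' {i | k ≤ i ∧ i ≤ n}) =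
      (((Finset.Icc k n).image (fun i => (X : ℝ[X]) ^ i) : Finset ℝ[X]) : Set ℝ[X]) := by
    intro k; ext; simp
  have hcard : ∀ k, ((Finset.Icc k n).image (fun i => (X : ℝ[X]) ^ i)).card ≤ n + 1 - k := by
    intro k
    exact Finset.card_image_le.trans (by simp)
  by_cases hγ : γ = 0
  · by_cases hβ : β = 0
    · left
      have hα : α ≠ 0 := fun h0 => hne ⟨h0, hβ, hγ⟩
      rw [hset]
      refine span_eq n V hdim _ ((hcard 1).trans (by omega)) fun f hf => ?_
      rw [← hset]
      obtain ⟨g, hg, e⟩ := expand' n 1 (by omega) f (hVP hf)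
      have h0 : f.coeff 0 = 0 := by
        have := h f hf
        simpa [hβ, hγ, hα] using this
      rw [e]
      simpa [h0] using hg
    · right; left
      refine ⟨-α / β, ?_⟩
      rw [hset, ← Finset.coe_singleton, ← Finset.coe_union]
      refine span_eq n V hdim _ ?_ fun f hf => ?_
      · refine (Finset.card_union_le _ _).trans ?_
        have := hcard 2
        simp only [Finset.card_singleton]
        omega
      · rw [Finset.coe_union, ← hset]
        obtain ⟨g, hg, e⟩ := expand' n 2 (by omega) f (hVP hf)
        have h1 : f.coeff 1 = f.coeff 0 * (-α / β) := by
          have := h f hf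
          rw [hγ] at this
          field_simp
          linear_combination this
        have e' : f = f.coeff 0 • (1 + C (-α / β) * X) + g := by
          conv_lhs => rw [e]
          simp only [Finset.sum_range_succ, Finset.sum_range_zero, h1, smul_eq_C_mul, C_mul]
          ring
        rw [e']
        refine Submodule.add_mem _ (Submodule.smul_mem _ _ (Submodule.subset_span (by simp))) ?_
        exact Submodule.span_mono Set.subset_union_right hg
  · right; right
    refine ⟨-α / γ, -β / γ, ?_⟩
    have hpair : ∀ a b : ℝ[X], ({a, b} : Set ℝ[X]) = (({a, b} : Finset ℝ[X]) : Set ℝ[X]) := by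
      intro a b; simp
    rw [hset, hpair, ← Finset.coe_union]
    refine span_eq n V hdim _ ?_ fun f hf => ?_
    · refine (Finset.card_union_le _ _).trans ?_
      have := hcard 3
      have h2 := Finset.card_le_two (a := (1 + C (-α / γ) * X ^ 2 : ℝ[X]))
        (b := X + C (-β / γ) * X ^ 2)
      omega
    · rw [Finset.coe_union, ← hset]
      obtain ⟨g, hg, e⟩ := expand' n 3 (by omega) f (hVP hf)
      have h1 : f.coeff 2 = f.coeff 0 * (-α / γ) + f.coeff 1 * (-β / γ) := by
        have := h f hf
        field_simp
        linear_combination this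
      have e' : f = f.coeff 0 • (1 + C (-α / γ) * X ^ 2)
          + f.coeff 1 • (X + C (-β / γ) * X ^ 2) + g := by
        conv_lhs => rw [e]
        simp only [Finset.sum_range_succ, Finset.sum_range_zero, h1, smul_eq_C_mul, C_mul, C_add]
        ring
      rw [e']
      refine Submodule.add_mem _ (Submodule.add_mem _
        (Submodule.smul_mem _ _ (Submodule.subset_span (by simp)))
        (Submodule.smul_mem _ _ (Submodule.subset_span (by simp)))) ?_
      exact Submodule.span_mono Set.subset_union_right hg

lemma real_jet (U : Submodule ℝ ℝ[X]) (x₀ : ℝ) (α β γ : ℂ) (hne : ¬ (α = 0 ∧ β = 0 ∧ γ = 0))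
    (h : ∀ y ∈ U, jet x₀ α β γ (y.map (algebraMap ℝ ℂ)) = 0) :
    ∃ a b c : ℝ, ¬ (a = 0 ∧ b = 0 ∧ c = 0) ∧ ∀ y ∈ U,
      a * y.eval x₀ + b * (derivative y).eval x₀ + c * (derivative (derivative y)).eval x₀ = 0 := by
  have hev : ∀ y : ℝ[X], (y.map (algebraMap ℝ ℂ)).eval (x₀ : ℂ) = ((y.eval x₀ : ℝ) : ℂ) := by
    intro y
    exact eval_map_apply (f := algebraMap ℝ ℂ) (p := y) x₀
  have h' : ∀ y ∈ U, α * (y.eval x₀ : ℝ) + β * ((derivative y).eval x₀ : ℝ)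
      + γ * ((derivative (derivative y)).eval x₀ : ℝ) = 0 := by
    intro y hy
    have := h y hy
    rw [jet_apply, derivative_map, derivative_map, hev, hev, hev] at this
    exact this
  by_cases hre : α.re = 0 ∧ β.re = 0 ∧ γ.re = 0
  · refine ⟨α.im, β.im, γ.im, fun him => hne ?_, fun y hy => ?_⟩
    · exact ⟨Complex.ext hre.1 him.1, Complex.ext hre.2.1 him.2.1, Complex.ext hre.2.2 him.2.2⟩
    · have := congrArg Complex.im (h' y hy)
      simpa using this
  · refine ⟨α.re, β.re, γ.re, hre, fun y hy => ?_⟩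
    have := congrArg Complex.re (h' y hy)
    simpa using this

lemma bad_conj (p q r : RatFunc ℝ) (c : ℂ) (h : Bad p q r c) :
    Bad p q r (starRingEnd ℂ c) := by
  have key : ∀ D : ℝ[X], aeval c D = 0 → aeval (starRingEnd ℂ c) D = 0 := by
    intro D hD
    rw [aeval_conj, hD, map_zero]
  rcases h with h | h | h
  · exact Or.inl (key _ h)
  · exact Or.inr (Or.inl (key _ h))
  · exact Or.inr (Or.inr (key _ h))

end S6

/-- A nonpolynomial second-order operator with rational coefficients leaving invariant
a codimension-1 subspace `U ⊂ P_n`, `n ≥ 5`, has exactly one pole `x₀` (the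
denominators of `p, q, r` are powers of `x − x₀`), and, after translating `x₀` to the
origin, `U` has a basis of one of the three indicated forms. -/
theorem stmt6 (n : ℕ) (hn : 5 ≤ n) (U : Submodule ℝ (Polynomial ℝ))
    (hUP : U ≤ Polynomial.degreeLT ℝ (n + 1))
    (hdim : Module.finrank ℝ U = n)
    (p q r : RatFunc ℝ)
    (hnonpoly : ¬((∃ P : Polynomial ℝ, p = algebraMap (Polynomial ℝ) (RatFunc ℝ) P) ∧
        (∃ Q : Polynomial ℝ, q = algebraMap (Polynomial ℝ) (RatFunc ℝ) Q) ∧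
        (∃ R : Polynomial ℝ, r = algebraMap (Polynomial ℝ) (RatFunc ℝ) R)))
    (hinv : ∀ y ∈ U, ∃ z ∈ U, TR p q r y = algebraMap (Polynomial ℝ) (RatFunc ℝ) z) :
    ∃ x₀ : ℝ,
      (∃ (N : ℕ) (P Q R : Polynomial ℝ),
        p * algebraMap (Polynomial ℝ) (RatFunc ℝ) ((X - C x₀) ^ N) =
          algebraMap (Polynomial ℝ) (RatFunc ℝ) P ∧
        q * algebraMap (Polynomial ℝ) (RatFunc ℝ) ((X - C x₀) ^ N) =
          algebraMap (Polynomial ℝ) (RatFunc ℝ) Q ∧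
        r * algebraMap (Polynomial ℝ) (RatFunc ℝ) ((X - C x₀) ^ N) =
          algebraMap (Polynomial ℝ) (RatFunc ℝ) R) ∧
      (Submodule.map (Polynomial.aeval (X + C x₀ : Polynomial ℝ)).toLinearMap U =
          Submodule.span ℝ ((fun i => (X : Polynomial ℝ) ^ i) '' {i | 1 ≤ i ∧ i ≤ n}) ∨
        (∃ a : ℝ, Submodule.map (Polynomial.aeval (X + C x₀ : Polynomial ℝ)).toLinearMap U =
          Submodule.span ℝ ({1 + C a * X} ∪
            (fun i => (X : Polynomial ℝ) ^ i) '' {i | 2 ≤ i ∧ i ≤ n})) ∨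
        (∃ a₁ a₂ : ℝ, Submodule.map (Polynomial.aeval (X + C x₀ : Polynomial ℝ)).toLinearMap U =
          Submodule.span ℝ ({1 + C a₁ * X ^ 2, X + C a₂ * X ^ 2} ∪
            (fun i => (X : Polynomial ℝ) ^ i) '' {i | 3 ≤ i ∧ i ≤ n}))) := by
  classical
  have hbad : ∃ c, S6.Bad p q r c := by
    by_contra hcon
    apply hnonpoly
    refine ⟨?_, ?_, ?_⟩
    · by_contra hh
      obtain ⟨c, hc⟩ := S6.bad_of_denom p hh
      exact hcon ⟨c, Or.inl hc⟩
    · by_contra hh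
      obtain ⟨c, hc⟩ := S6.bad_of_denom q hh
      exact hcon ⟨c, Or.inr (Or.inl hc)⟩
    · by_contra hh
      obtain ⟨c, hc⟩ := S6.bad_of_denom r hh
      exact hcon ⟨c, Or.inr (Or.inr hc)⟩
  have huniq := S6.bad_unique n hn U hUP hdim p q r hinv
  obtain ⟨c, hc⟩ := hbad
  obtain ⟨x₀, rfl⟩ := Complex.conj_eq_iff_real.mp (huniq _ _ (S6.bad_conj p q r c hc) hc)
  refine ⟨x₀, ?_, ?_⟩
  · have ep := S6.monic_eq p.denom p.monic_denom x₀ fun d hd => huniq _ _ (Or.inl hd) hc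
    have eq := S6.monic_eq q.denom q.monic_denom x₀ fun d hd => huniq _ _ (Or.inr (Or.inl hd)) hc
    have er := S6.monic_eq r.denom r.monic_denom x₀ fun d hd => huniq _ _ (Or.inr (Or.inr hd)) hc
    set N := p.denom.natDegree + q.denom.natDegree + r.denom.natDegree with hN
    obtain ⟨P, hP⟩ := S6.denom_mul p x₀ N (by
      conv_lhs => rw [ep]
      exact pow_dvd_pow _ (by omega))
    obtain ⟨Q, hQ⟩ := S6.denom_mul q x₀ N (by
      conv_lhs => rw [eq]
      exact pow_dvd_pow _ (by omega))
    obtain ⟨R, hR⟩ := S6.denom_mul r x₀ N (by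
      conv_lhs => rw [er]
      exact pow_dvd_pow _ (by omega))
    exact ⟨N, P, Q, R, hP, hQ, hR⟩
  · obtain ⟨α, β, γ, hne, h⟩ := S6.bad_jet U p q r hinv _ hc
    obtain ⟨a, b, e, hne', h'⟩ := S6.real_jet U x₀ α β γ hne h
    have htay : ∀ f : Polynomial ℝ,
        (Polynomial.aeval (X + C x₀ : Polynomial ℝ)).toLinearMap f = taylor x₀ f := by
      intro f
      simp [taylor_apply, Polynomial.comp, aeval_def]
    have hinj : Function.Injective (Polynomial.aeval (R := ℝ) (X + C x₀ : Polynomial ℝ)).toLinearMap := by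
      intro f g hfg
      rw [htay, htay] at hfg
      exact taylor_injective x₀ hfg
    refine S6.forms n hn _ ?_ ?_ a b (2 * e) ?_ ?_
    · rintro _ ⟨f, hf, rfl⟩
      have := hUP hf
      rw [htay, mem_degreeLT] at *
      rwa [degree_taylor]
    · rw [← (Submodule.equivMapOfInjective _ hinj U).finrank_eq, hdim]
    · simpa using hne'
    · rintro _ ⟨f, hf, rfl⟩
      rw [htay, taylor_coeff_zero, taylor_coeff_one, taylor_coeff]
      have := h' f hf
      have h2 : (derivative (derivative f)).eval x₀ = 2 * (hasseDeriv 2 f).eval x₀ := by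
        have := congrFun (factorial_smul_hasseDeriv (R := ℝ) 2) f
        have := congrArg (eval x₀) this
        simp at this
        simpa using this.symm
      rw [h2] at this
      linear_combination this
end

section
/- Up to affine transformations of x, the flag spanned by {x+1, x², x³, ...} is the unique primitive polynomial flag of stable codimension 1 that is exceptional, i.e., that is preserved by some second-order operator with rational coefficients which does not preserve the standard polynomial flag. -/
open Polynomial

/-- The subspaces of the exceptional flag spanned by `x+1, x², x³, …`:
`E k = span{x+1, x², …, x^k}`. -/
noncomputable def flagE (k : ℕ) : Submodule ℝ (Polynomial ℝ) :=
  Submodule.span ℝ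
    ({X + 1} ∪ (fun i => (X : Polynomial ℝ) ^ i) '' {i | 2 ≤ i ∧ i ≤ k})


lemma deg_of_mem (y : Polynomial ℝ) (k : ℕ) (h : y.degree < ((k + 1 : ℕ) : WithBot ℕ)) :
    y.natDegree ≤ k := by
  rw [natDegree_le_iff_coeff_eq_zero]
  rw [degree_lt_iff_coeff_zero] at h
  exact fun m hm => h m hm

lemma deg_sub {y z : Polynomial ℝ} {k : ℕ} (hy : y.natDegree ≤ k) (hz : z.natDegree ≤ k) :
    (y - z).natDegree ≤ k :=
  (natDegree_sub_le y z).trans (max_le hy hz)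

lemma flag_exists (U : ℕ → Submodule ℝ (Polynomial ℝ))
    (hflag : ∀ k, 1 ≤ k → U k ≤ U (k + 1))
    (hcodim : ∀ k, 1 ≤ k → U k ≤ Polynomial.degreeLT ℝ (k + 1) ∧
      ¬U k ≤ Polynomial.degreeLT ℝ k) (k : ℕ) (hk : 1 ≤ k) :
    ∀ y : Polynomial ℝ, y.natDegree ≤ k → ∃ c : ℝ, y - C c ∈ U k := by
  have hlead : ∀ k, 1 ≤ k → ∃ e ∈ U k, e.natDegree ≤ k ∧ e.coeff k ≠ 0 := by
    intro k hk
    obtain ⟨h1, h2⟩ := hcodim k hk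
    obtain ⟨e, he, hne⟩ := SetLike.not_le_iff_exists.1 h2
    have h3 := h1 he
    rw [mem_degreeLT] at h3 hne
    have h4 : e.natDegree ≤ k := by
      exact deg_of_mem _ _ h3
    refine ⟨e, he, h4, fun h0 => hne ?_⟩
    rw [degree_lt_iff_coeff_zero]
    intro m hm
    rcases hm.eq_or_lt with rfl | hm
    · exact h0
    · exact coeff_eq_zero_of_natDegree_lt (by omega)
  have hred : ∀ k, ∀ e y : Polynomial ℝ, e.natDegree ≤ k + 1 → e.coeff (k+1) ≠ 0 →
      y.natDegree ≤ k + 1 → (y - C (y.coeff (k+1) / e.coeff (k+1)) * e).natDegree ≤ k := by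
    intro k e y he h0 hy
    rw [natDegree_le_iff_coeff_eq_zero]
    intro m hm
    rw [coeff_sub, coeff_C_mul]
    rcases (Nat.succ_le_of_lt hm).eq_or_lt with h | h
    · subst h
      simp only [Nat.succ_eq_add_one]
      field_simp
      ring
    · rw [coeff_eq_zero_of_natDegree_lt (show y.natDegree < m by omega),
        coeff_eq_zero_of_natDegree_lt (show e.natDegree < m by omega)]
      ring
  induction k, hk using Nat.le_induction with
  | base =>
    intro y hy
    obtain ⟨e, he, hd, h0⟩ := hlead 1 le_rfl
    have h := hred 0 e y hd h0 hy
    have h' := eq_C_of_natDegree_le_zero h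
    refine ⟨(y - C (y.coeff (0 + 1) / e.coeff (0 + 1)) * e).coeff 0, ?_⟩
    · rw [← h', sub_sub_cancel, ← smul_eq_C_mul]
      exact Submodule.smul_mem _ _ he
  | succ k hk ih =>
    intro y hy
    obtain ⟨e, he, hd, h0⟩ := hlead (k+1) (by omega)
    obtain ⟨c, hc⟩ := ih _ (hred k e y hd h0 hy)
    refine ⟨c, ?_⟩
    have h2 := Submodule.add_mem _ (hflag k hk hc)
      (Submodule.smul_mem _ (y.coeff (k+1) / e.coeff (k+1)) he)
    rw [smul_eq_C_mul] at h2
    convert h2 using 1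
    ring

lemma flag_const (U : ℕ → Submodule ℝ (Polynomial ℝ))
    (hdim : ∀ k, 1 ≤ k → Module.finrank ℝ (U k) = k)
    (hflag : ∀ k, 1 ≤ k → U k ≤ U (k + 1))
    (hcodim : ∀ k, 1 ≤ k → U k ≤ Polynomial.degreeLT ℝ (k + 1) ∧
      ¬U k ≤ Polynomial.degreeLT ℝ k) (k : ℕ) (hk : 1 ≤ k) (c : ℝ) (hc : C c ∈ U k) :
    c = 0 := by
  by_contra h0
  have hall : Polynomial.degreeLT ℝ (k + 1) ≤ U k := by
    intro y hy
    have hyd : y.natDegree ≤ k := by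
      rw [mem_degreeLT] at hy
      exact deg_of_mem _ _ hy
    obtain ⟨b, hb⟩ := flag_exists U hflag hcodim k hk y hyd
    have h2 := Submodule.add_mem _ hb (Submodule.smul_mem _ (b / c) hc)
    rw [smul_eq_C_mul, ← C_mul, div_mul_cancel₀ _ h0, sub_add_cancel] at h2
    exact h2
  have : FiniteDimensional ℝ (U k) := by
    apply Module.finite_of_finrank_pos
    rw [hdim k hk]; omega
  have h3 := Submodule.finrank_mono hall
  rw [hdim k hk, (degreeLTEquiv ℝ (k+1)).finrank_eq] at h3
  simp at h3

noncomputable def Phi (u : Polynomial ℝ) (b : ℝ) (y : Polynomial ℝ) : Polynomial ℝ :=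
  y - u * derivative y + C (1/2) * (u^2 + C b) * derivative (derivative y)

lemma C_half_two : (C (1/2) : Polynomial ℝ) * 2 = 1 := by
  rw [show (2 : Polynomial ℝ) = C 2 from rfl, ← C_mul]; norm_num

lemma natDegree_D (y : Polynomial ℝ) (m : ℕ) (h : y.natDegree ≤ m) (j : ℕ) (P : Polynomial ℝ)
    (hP : P.natDegree ≤ j) : (P * derivative^[j] y).natDegree ≤ m := by
  by_cases hj : derivative^[j] y = 0
  · rw [hj]; simp
  have h1 : j ≤ y.natDegree := by
    by_contra hh
    exact hj (iterate_derivative_eq_zero (by omega))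
  have h2 := natDegree_iterate_derivative y j
  have h3 := natDegree_mul_le (p := P) (q := derivative^[j] y)
  omega

/-- the nonpolynomial operator case, in terms of polynomials only -/
lemma core_root (U : ℕ → Submodule ℝ (Polynomial ℝ)) (a b : ℝ)
    (hconst : ∀ k, 1 ≤ k → ∀ c : ℝ, C c ∈ U k → c = 0)
    (hU : ∀ k, 1 ≤ k → ∀ y ∈ U k, y.natDegree ≤ k)
    (N D w A : Polynomial ℝ) (hD : ¬ IsUnit D) (hD0 : D ≠ 0) (hcop : IsCoprime N D)
    (H : ∀ k, 1 ≤ k → ∀ y : Polynomial ℝ, y.natDegree ≤ k → ∃ c : ℝ, ∃ z,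
      y - C c ∈ U k ∧ z ∈ U k ∧ N * (Phi (X - C a) b y - C c) =
        D * (z - w * derivative y - C (1/2) * A * derivative (derivative y))) :
    ∃ ξ : ℝ, (ξ - a)^2 + b = 0 ∧ ∀ k, 1 ≤ k → ∀ y : Polynomial ℝ, y.natDegree ≤ k →
      (y ∈ U k ↔ (Phi (X - C a) b y).eval ξ = 0) := by
  obtain ⟨d, hd, hdD⟩ := WfDvdMonoid.exists_irreducible_factor hD hD0
  have hdC : ∀ c : ℝ, d ∣ C c → c = 0 := by
    intro c hc
    by_contra h0
    exact hd.not_isUnit (isUnit_of_dvd_unit hc (isUnit_C.2 (isUnit_iff_ne_zero.2 h0)))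
  have HD : ∀ k, 1 ≤ k → ∀ y : Polynomial ℝ, y.natDegree ≤ k → ∃ c : ℝ,
      y - C c ∈ U k ∧ D ∣ (Phi (X - C a) b y - C c) := by
    intro k hk y hy
    obtain ⟨c, z, h1, h2, h3⟩ := H k hk y hy
    exact ⟨c, h1, hcop.symm.dvd_of_dvd_mul_left (Dvd.intro _ h3.symm)⟩
  have mem : ∀ k, 1 ≤ k → ∀ y : Polynomial ℝ, y.natDegree ≤ k →
      (y ∈ U k ↔ d ∣ Phi (X - C a) b y) := by
    intro k hk y hy
    obtain ⟨c, h1, h2⟩ := HD k hk y hy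
    have h3 := hdD.trans h2
    constructor
    · intro h
      have := hconst k hk c (by simpa using Submodule.sub_mem _ h h1)
      simpa [this] using h3
    · intro h
      have := hdC c (by simpa using dvd_sub h h3)
      simpa [this] using h1
  have HDd : ∀ y : Polynomial ℝ, ∃ c : ℝ, d ∣ (Phi (X - C a) b y - C c) := by
    intro y
    obtain ⟨c, h1, h2⟩ := HD (y.natDegree + 1) (by omega) y (by omega)
    exact ⟨c, hdD.trans h2⟩
  -- degree of d is one
  have hdeg : d.natDegree = 1 := by
    have hpos : 0 < d.natDegree := hd.natDegree_pos
    by_contra hne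
    obtain ⟨k1, h1⟩ := HDd (d^2)
    obtain ⟨k2, h2⟩ := HDd ((X - C a) * d^2)
    have e1 : d ∣ ((X - C a)^2 + C b) * (derivative d)^2 - C k1 := by
      have : ((X - C a)^2 + C b) * (derivative d)^2 - C k1 = (Phi (X - C a) b (d^2) - C k1)
          - d * (d - (X - C a) * (2 * derivative d) +
            ((X - C a)^2 + C b) * derivative (derivative d)) := by
        simp only [Phi, pow_two, derivative_mul, derivative_add]
        linear_combination (-((X - C a) * (X - C a) + C b) * (derivative d * derivative d + d * derivative (derivative d))) * C_half_two
      rw [this]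
      exact dvd_sub h1 (Dvd.intro _ rfl)
    have e2 : d ∣ (X - C a) * (((X - C a)^2 + C b) * (derivative d)^2) - C k2 := by
      have : (X - C a) * (((X - C a)^2 + C b) * (derivative d)^2) - C k2
          = (Phi (X - C a) b ((X - C a) * d^2) - C k2)
          - d * ( - (X - C a) * ((X - C a) * (2 * derivative d)) +
            ((X - C a)^2 + C b) * (2 * derivative d + (X - C a) * derivative (derivative d))) := by
        simp only [Phi, pow_two, derivative_mul, derivative_add, derivative_sub, derivative_X,
          derivative_C, derivative_one, derivative_zero, sub_zero]
        linear_combination (-((X - C a) * (X - C a) + C b) * (2 * d * derivative d + (X - C a) * (derivative d * derivative d + d * derivative (derivative d)))) * C_half_two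
      rw [this]
      exact dvd_sub h2 (Dvd.intro _ rfl)
    have e3 : d ∣ C k1 * (X - C a) - C k2 := by
      have := dvd_sub e2 (Dvd.dvd.mul_left e1 (X - C a))
      convert this using 1
      ring
    have e4 : C k1 * (X - C a) - C k2 = 0 := by
      apply eq_zero_of_dvd_of_natDegree_lt e3
      have : (C k1 * (X - C a) - C k2).natDegree ≤ 1 := by compute_degree
      omega
    have e5 : k1 = 0 := by
      have := congrArg (fun f => coeff f 1) e4
      simpa [coeff_C] using this
    rw [e5, C_0, sub_zero] at e1
    have e6 : d ∣ (X - C a)^2 + C b := by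
      rcases hd.prime.dvd_or_dvd e1 with h | h
      · exact h
      · exfalso
        have h := hd.prime.dvd_of_dvd_pow h
        have h0 : derivative d = 0 := by
          apply eq_zero_of_dvd_of_natDegree_lt h
          exact natDegree_derivative_lt (by omega)
        have := derivative_eq_zero.1 h0
        omega
    obtain ⟨c3, h3⟩ := HDd ((X - C a)^3)
    have e7 : d ∣ C (2 * b) * (X - C a) - C c3 := by
      have : C (2 * b) * (X - C a) - C c3 = (Phi (X - C a) b ((X - C a)^3) - C c3)
          - (X - C a) * ((X - C a)^2 + C b) := by
        simp only [Phi, pow_succ, pow_zero, one_mul, derivative_mul, derivative_add, derivative_sub,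
          derivative_X, derivative_C, derivative_one, C_mul, derivative_zero, sub_zero]
        rw [show (C 2 : Polynomial ℝ) = 2 from rfl]
        linear_combination (-((X - C a) * (X - C a) + C b) * (3 * (X - C a))) * C_half_two
      rw [this]
      exact dvd_sub h3 (Dvd.dvd.mul_left e6 _)
    have e8 : C (2 * b) * (X - C a) - C c3 = 0 := by
      apply eq_zero_of_dvd_of_natDegree_lt e7
      have : (C (2 * b) * (X - C a) - C c3).natDegree ≤ 1 := by compute_degree
      omega
    have e9 : b = 0 := by
      have := congrArg (fun f => coeff f 1) e8
      simp only [coeff_sub, coeff_C_mul, coeff_X_one, coeff_C, coeff_zero] at this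
      norm_num at this
      exact this
    rw [e9, C_0, add_zero] at e6
    have h := hd.prime.dvd_of_dvd_pow e6
    have := natDegree_le_of_dvd h (X_sub_C_ne_zero a)
    rw [natDegree_X_sub_C] at this
    omega
  obtain ⟨ξ, hξ⟩ := exists_root_of_degree_eq_one ((degree_eq_iff_natDegree_eq hd.ne_zero).2 hdeg)
  have hass : Associated (X - C ξ) d :=
    (irreducible_X_sub_C ξ).associated_of_dvd hd (dvd_iff_isRoot.2 hξ)
  have hdvd : ∀ f : Polynomial ℝ, d ∣ f ↔ f.eval ξ = 0 := by
    intro f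
    rw [← hass.dvd_iff_dvd_left, dvd_iff_isRoot, IsRoot.def]
  refine ⟨ξ, ?_, fun k hk y hy => by rw [mem k hk y hy, hdvd]⟩
  by_contra hne
  obtain ⟨D1, hD1⟩ := dvd_iff_isRoot.2 ((hdvd D).1 hdD)
  have hD1ne : D1.eval ξ ≠ 0 := by
    intro h0
    obtain ⟨D2, hD2⟩ := dvd_iff_isRoot.2 h0
    obtain ⟨c, -, g, hg⟩ := HD 3 (by norm_num) ((X - C a)^3) (by compute_degree)
    have h1 := congrArg (fun f => (derivative f).eval ξ) hg
    rw [hD1, hD2] at h1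
    simp [Phi, pow_succ] at h1
    apply hne
    linear_combination h1 / 3
  have hNne : N.eval ξ ≠ 0 := by
    intro h0
    obtain ⟨s, t, hst⟩ := hcop
    have := congrArg (eval ξ) hst
    simp [h0, (hdvd D).1 hdD] at this
  have hz5 : ((X - C ξ)^5 : Polynomial ℝ).natDegree ≤ 5 := by compute_degree
  obtain ⟨c, z, h1, h2, h3⟩ := H 5 (by norm_num) ((X - C ξ)^5) hz5
  have hc : c = 0 := by
    have h5 : ((X - C ξ)^5 : Polynomial ℝ) ∈ U 5 := by
      rw [mem 5 (by norm_num) _ hz5, hdvd]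
      simp [Phi, pow_succ]
    exact hconst 5 (by norm_num) c (by simpa using Submodule.sub_mem _ h5 h1)
  have hPz : (Phi (X - C a) b z).eval ξ = 0 := by
    rw [← hdvd, ← mem 5 (by norm_num) z (hU 5 (by norm_num) z h2)]
    exact h2
  have h4 : D1 * z = (X - C ξ)^2 * ((X - C ξ) * (D1 * (5 * w * (X - C ξ) + 10 * A)
      + N * ((X - C ξ) - 5 * (X - C a))) + 10 * N * ((X - C a)^2 + C b)) := by
    apply mul_left_cancel₀ (X_sub_C_ne_zero ξ)
    rw [hc, hD1] at h3
    have d1 : derivative ((X - C ξ)^5 : Polynomial ℝ) = 5 * (X - C ξ)^4 := by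
      rw [derivative_X_sub_C_pow]; norm_num
      left; rfl
    have d2 : derivative (5 * (X - C ξ)^4 : Polynomial ℝ) = 20 * (X - C ξ)^3 := by
      rw [derivative_mul, derivative_X_sub_C_pow]; norm_num
      rw [show (C 4 : Polynomial ℝ) = 4 from rfl]; ring
    simp only [Phi, d1, d2, C_0] at h3
    linear_combination -h3 + (10 * (X - C ξ)^3 * (((X - C ξ) * D1) * A
      + N * ((X - C a)^2 + C b))) * C_half_two
  have h5 : (X - C ξ)^2 ∣ z := by
    have hco : IsCoprime ((X - C ξ)^2) D1 := by
      apply IsCoprime.pow_left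
      rw [(irreducible_X_sub_C ξ).coprime_iff_not_dvd, dvd_iff_isRoot]
      exact hD1ne
    exact hco.dvd_of_dvd_mul_left (Dvd.intro _ h4.symm)
  obtain ⟨v, rfl⟩ := h5
  have h6 : v.eval ξ = 0 := by
    simp [Phi, pow_two] at hPz
    rcases hPz with h | h
    · exact absurd (by linear_combination h) hne
    · linarith
  have h7 : D1 * v = ((X - C ξ) * (D1 * (5 * w * (X - C ξ) + 10 * A)
      + N * ((X - C ξ) - 5 * (X - C a))) + 10 * N * ((X - C a)^2 + C b)) := by
    apply mul_left_cancel₀ (pow_ne_zero 2 (X_sub_C_ne_zero ξ))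
    rw [← h4]; ring
  have h8 := congrArg (eval ξ) h7
  simp [h6, hNne] at h8
  exact hne h8

/-- Up to affine transformations of `x`, the flag spanned by `{x+1, x², x³, …}` is the
unique primitive polynomial flag of stable codimension 1 preserved by a second-order
operator with rational coefficients that does not preserve the standard flag. -/
theorem stmt8 (U : ℕ → Submodule ℝ (Polynomial ℝ))
    (hdim : ∀ k, 1 ≤ k → Module.finrank ℝ (U k) = k)
    (hflag : ∀ k, 1 ≤ k → U k ≤ U (k + 1))
    (hcodim : ∀ k, 1 ≤ k → U k ≤ Polynomial.degreeLT ℝ (k + 1) ∧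
      ¬U k ≤ Polynomial.degreeLT ℝ k)
    (hprim : ∀ d : Polynomial ℝ, (∀ k, 1 ≤ k → ∀ y ∈ U k, d ∣ y) → d.natDegree = 0)
    (hexc : ∃ p q r : RatFunc ℝ,
      (∀ k, 1 ≤ k → ∀ y ∈ U k, ∃ z ∈ U k,
        TR p q r y = algebraMap (Polynomial ℝ) (RatFunc ℝ) z) ∧
      ¬(∀ (m : ℕ) (y : Polynomial ℝ), y.natDegree ≤ m → ∃ z : Polynomial ℝ,
        z.natDegree ≤ m ∧ TR p q r y = algebraMap (Polynomial ℝ) (RatFunc ℝ) z)) :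
    ∃ s t : ℝ, s ≠ 0 ∧ ∀ k, 1 ≤ k →
      U k = Submodule.map (Polynomial.aeval (C s * X + C t : Polynomial ℝ)).toLinearMap
        (flagE k) := by
  
  have hE := flag_exists U hflag hcodim
  have hconst := flag_const U hdim hflag hcodim
  have hU : ∀ k, 1 ≤ k → ∀ y ∈ U k, y.natDegree ≤ k := by
    intro k hk y hy
    have h3 := (hcodim k hk).1 hy
    rw [mem_degreeLT] at h3
    exact deg_of_mem _ _ h3
  obtain ⟨p, q, r, hT, hnot⟩ := hexc
  obtain ⟨a, ha⟩ := hE 1 le_rfl X natDegree_X_le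
  obtain ⟨b, hb⟩ := hE 2 (by norm_num) ((X - C a)^2) (by compute_degree)
  obtain ⟨w, hw, hTw⟩ := hT 1 le_rfl _ ha
  obtain ⟨z2, hz2, hTz2⟩ := hT 2 (by norm_num) _ hb
  have hwd := hU 1 le_rfl w hw
  have hz2d := hU 2 (by norm_num) z2 hz2
  set u : Polynomial ℝ := X - C a with hu
  have hud : u.natDegree = 1 := natDegree_X_sub_C a
  have du : derivative u = 1 := by simp [hu]
  let ι := algebraMap (Polynomial ℝ) (RatFunc ℝ)
  have hι : Function.Injective ι := RatFunc.algebraMap_injective ℝ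
  have hq : q = ι w - r * ι u := by
    simp only [TR, du, derivative_one, map_zero, map_one] at hTw
    linear_combination hTw
  obtain ⟨A, hA⟩ : ∃ A, A = z2 - 2 * u * w := ⟨_, rfl⟩
  have hhalf : ι (C (1/2)) * 2 = 1 := by
    have := congrArg ι C_half_two
    rwa [map_mul, map_one, map_ofNat] at this
  have hp : p = ι (C (1/2)) * (ι A + r * ι (u^2 + C b)) := by
    have d1 : derivative (u^2 - C b) = 2 * u := by
      rw [pow_two]; simp [du]; ring
    have d2 : derivative (2 * u) = 2 := by
      simp [du]
    simp only [TR, d1, d2] at hTz2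
    change p * ι 2 + q * ι (2 * u) + r * ι (u^2 - C b) = ι z2 at hTz2
    rw [hq] at hTz2
    simp only [map_sub, map_mul, map_add, map_pow, map_ofNat, hA] at hTz2 ⊢
    linear_combination ι (C (1/2)) * hTz2 - p * hhalf
  have hAd : A.natDegree ≤ 2 := by
    rw [hA]
    refine deg_sub hz2d ?_
    have h1 := natDegree_mul_le (p := 2 * u) (q := w)
    have h2 := natDegree_mul_le (p := 2) (q := u)
    have h3 : (2 : Polynomial ℝ).natDegree = 0 := natDegree_ofNat 2
    omega
  have hTy : ∀ y c, TR p q r (y - C c) = r * ι (Phi u b y - C c) + ι (w * derivative y)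
      + ι (C (1/2) * A * derivative (derivative y)) := by
    intro y c
    simp only [TR, Phi, derivative_sub, derivative_C, sub_zero]
    change p * ι _ + q * ι _ + r * ι _ = _
    rw [hp, hq]
    simp only [map_sub, map_mul, map_add, map_pow]
    ring
  have hD0 : r.denom ≠ 0 := r.denom_ne_zero
  have hr : r * ι r.denom = ι r.num := by
    have h1 := RatFunc.num_div_denom r
    have h2 : ι r.denom ≠ 0 := by
      rw [Ne, map_eq_zero_iff ι hι]; exact hD0
    rw [div_eq_iff h2] at h1
    exact h1.symm
  have H : ∀ k, 1 ≤ k → ∀ y : Polynomial ℝ, y.natDegree ≤ k → ∃ c : ℝ, ∃ z,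
      y - C c ∈ U k ∧ z ∈ U k ∧ r.num * (Phi u b y - C c) =
        r.denom * (z - w * derivative y - C (1/2) * A * derivative (derivative y)) := by
    intro k hk y hy
    obtain ⟨c, hc⟩ := hE k hk y hy
    obtain ⟨z, hz, h⟩ := hT k hk _ hc
    refine ⟨c, z, hc, hz, hι ?_⟩
    rw [hTy] at h
    change _ = ι z at h
    rw [map_mul, map_mul, map_sub _ (z - _), map_sub _ z, ← hr]
    linear_combination ι r.denom * h
  have hDu : ¬ IsUnit r.denom := by
    intro hunit
    apply hnot
    obtain ⟨δ, hδ, hδ'⟩ := isUnit_iff.1 hunit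
    have hδ0 : δ ≠ 0 := hδ.ne_zero
    obtain ⟨R, hR⟩ : ∃ R, r = ι R := by
      refine ⟨C δ⁻¹ * r.num, ?_⟩
      rw [map_mul, ← hr, ← hδ', mul_left_comm, ← map_mul, ← C_mul, inv_mul_cancel₀ hδ0]
      simp
    have hRd : R.natDegree = 0 := by
      obtain ⟨c, hc⟩ := hE 3 (by norm_num) (u^3) (by rw [natDegree_pow, hud])
      obtain ⟨z, hz, h⟩ := hT 3 (by norm_num) _ hc
      rw [hTy, hR, ← map_mul, ← map_add, ← map_add] at h
      have h := hι h
      have hu3 : (u^3).natDegree ≤ 3 := by rw [natDegree_pow, hud]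
      have b1 := natDegree_D (u^3) 3 hu3 1 w hwd
      have b2 := natDegree_D (u^3) 3 hu3 2 (C (1/2) * A) ((natDegree_C_mul_le _ _).trans hAd)
      simp only [Function.iterate_succ, Function.iterate_zero, Function.comp, id] at b1 b2
      have h' : R * (Phi u b (u^3) - C c) = z - w * derivative (u^3)
          - C (1/2) * A * derivative (derivative (u^3)) := by linear_combination h
      have b3 : (R * (Phi u b (u^3) - C c)).natDegree ≤ 3 := by
        rw [h']
        exact deg_sub (deg_sub (hU 3 (by norm_num) z hz) b1) b2
      have e : Phi u b (u^3) - C c = u^3 + C (3 * b) * u + C (-c) := by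
        simp only [Phi, pow_succ, pow_zero, one_mul, derivative_mul, derivative_add, du,
          derivative_one, C_mul, derivative_zero, C_neg]
        rw [show (C 3 : Polynomial ℝ) = 3 from rfl]
        linear_combination ((u * u + C b) * (3 * u)) * C_half_two
      have e3 : (Phi u b (u^3) - C c).natDegree = 3 := by
        rw [e, hu]; compute_degree!
      by_cases hR0 : R = 0
      · simp [hR0]
      rw [natDegree_mul hR0 (by intro h0; rw [h0] at e3; simp at e3), e3] at b3
      omega
    intro m y hy
    have h := hTy y 0
    rw [C_0, sub_zero, sub_zero, hR, ← map_mul, ← map_add, ← map_add] at h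
    refine ⟨_, ?_, hR ▸ h⟩
    have hb2 : (C (1/2) * (u^2 + C b)).natDegree ≤ 2 := by rw [hu]; compute_degree
    have b0 := natDegree_D y m hy 1 u hud.le
    have b1 := natDegree_D y m hy 1 w hwd
    have b2 := natDegree_D y m hy 2 (C (1/2) * A) ((natDegree_C_mul_le _ _).trans hAd)
    have b3 := natDegree_D y m hy 2 _ hb2
    simp only [Function.iterate_succ, Function.iterate_zero, Function.comp, id] at b0 b1 b2 b3
    refine natDegree_add_le_of_degree_le (natDegree_add_le_of_degree_le ?_ b1) b2
    refine natDegree_mul_le.trans ?_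
    rw [hRd, zero_add]
    exact natDegree_add_le_of_degree_le (deg_sub hy b0) b3
  obtain ⟨ξ, hξ, hmem⟩ := core_root U a b hconst hU r.num r.denom w A hDu hD0
    r.isCoprime_num_denom H
  obtain ⟨η, hη⟩ : ∃ η, η = ξ - a := ⟨_, rfl⟩
  have hmem' : ∀ k, 1 ≤ k → ∀ y : Polynomial ℝ, y.natDegree ≤ k →
      (y ∈ U k ↔ y.eval ξ = η * (derivative y).eval ξ) := by
    intro k hk y hy
    rw [hmem k hk y hy]
    simp only [Phi, eval_add, eval_sub, eval_mul, eval_pow, eval_X, eval_C, hξ]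
    rw [hη]
    constructor <;> intro h <;> linear_combination h
  have hη0 : η ≠ 0 := by
    intro h0
    have := hprim (X - C ξ) (by
      intro k hk y hy
      rw [dvd_iff_isRoot]
      have := (hmem' k hk y (hU k hk y hy)).1 hy
      rw [h0, zero_mul] at this
      exact this)
    rw [natDegree_X_sub_C] at this
    omega
  refine ⟨η⁻¹, -ξ * η⁻¹, inv_ne_zero hη0, ?_⟩
  intro k hk
  set l : Polynomial ℝ := C η⁻¹ * X + C (-ξ * η⁻¹) with hl
  have hle : l.eval ξ = 0 := by simp [hl]; ring
  have hld : derivative l = C η⁻¹ := by simp [hl]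
  have hldeg : l.natDegree ≤ 1 := by rw [hl]; compute_degree
  apply le_antisymm
  · intro y hy
    have hyd := hU k hk y hy
    have h1 := (hmem' k hk y hyd).1 hy
    set g : Polynomial ℝ := y.comp (C η * X + C ξ) with hg
    have hyg : y = g.comp l := by
      rw [hg, comp_assoc]
      have : (C η * X + C ξ : Polynomial ℝ).comp l = X := by
        rw [hl]
        simp only [add_comp, mul_comp, C_comp, X_comp, mul_add, ← mul_assoc, ← C_mul]
        rw [mul_inv_cancel₀ hη0, show η * -ξ * η⁻¹ = -ξ by field_simp]
        simp
      rw [this, comp_X]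
    have hgd : g.natDegree < k + 1 := by
      have h2 : (C η * X + C ξ : Polynomial ℝ).natDegree ≤ 1 := by compute_degree
      have h3 := natDegree_comp_le (p := y) (q := C η * X + C ξ)
      have h4 := Nat.mul_le_mul hyd h2
      rw [← hg] at h3
      omega
    have hg01 : g.coeff 0 = g.coeff 1 := by
      have e0 : g.coeff 0 = y.eval ξ := by
        rw [coeff_zero_eq_eval_zero, hg, eval_comp]; simp
      have e1 : g.coeff 1 = η * (derivative y).eval ξ := by
        have : g.coeff 1 = (derivative g).eval 0 := by
          rw [← coeff_zero_eq_eval_zero, coeff_derivative]; simp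
        rw [this, hg, derivative_comp]; simp [eval_comp]
      rw [e0, e1, h1]
    refine ⟨g, ?_, ?_⟩
    · have hs := g.as_sum_range_C_mul_X_pow' hgd
      obtain ⟨j, rfl⟩ : ∃ j, k = j + 1 := ⟨k - 1, by omega⟩
      rw [Finset.sum_range_succ', Finset.sum_range_succ'] at hs
      have hs' : g = (∑ i ∈ Finset.range j, C (g.coeff (i+1+1)) * X^(i+1+1))
          + C (g.coeff 1) * (X + 1) := by
        rw [← hg01]
        conv_lhs => rw [hs]
        simp only [zero_add, ← hg01]
        ring
      rw [hs']
      refine Submodule.add_mem _ (Submodule.sum_mem _ ?_) ?_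
      · intro i hi
        rw [← smul_eq_C_mul]
        refine Submodule.smul_mem _ _ (Submodule.subset_span (Or.inr ⟨i+1+1, ?_, rfl⟩))
        have := Finset.mem_range.1 hi
        exact ⟨by omega, by omega⟩
      · rw [← smul_eq_C_mul]
        exact Submodule.smul_mem _ _ (Submodule.subset_span (Or.inl rfl))
    · rw [hyg]; rfl
  · rw [flagE, Submodule.map_span_le]
    rintro f (hf | ⟨i, ⟨hi2, hik⟩, rfl⟩)
    · rw [Set.mem_singleton_iff] at hf
      rw [hf]
      simp only [AlgHom.toLinearMap_apply, map_add, aeval_X, map_one]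
      have hd : (l + 1).natDegree ≤ k :=
        natDegree_add_le_of_degree_le (hldeg.trans hk) (by simp)
      rw [hmem' k hk _ hd]
      simp [hle, hld, hη0]
    · simp only [AlgHom.toLinearMap_apply, map_pow, aeval_X]
      have hd : (l ^ i).natDegree ≤ k := by
        have := natDegree_pow_le_of_le i hldeg
        omega
      rw [hmem' k hk _ hd]
      rw [derivative_pow]
      have h1 : i ≠ 0 := by omega
      have h2 : i - 1 ≠ 0 := by omega
      simp [hle, h1, h2]
end
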